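/- arXiv:1907.07025 — 3 statements merged into one kernel-verified Lean document; each statement's English description precedes it below -/
import Mathlib

section
/- Let G be a coset 2n-acyclic Cayley group with generator set E. If v_1, α_1, v_2, …, v_ℓ, α_ℓ, v_{ℓ+1} is a coset path in G such that [v_1]_{gen(v_1, v_{ℓ+1})} ∩ [v_i]_{α_{i−1} ∩ α_i} = ∅ for some 2 ≤ i ≤ ℓ, then ℓ > n. -/
open scoped Pointwise

section CayleyDefs

variable {G : Type*} [Group G]

/-- The `α`-coset of `v`, i.e. `v · ⟨α⟩` where `⟨α⟩` is the subgroup generated by `α`. -/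
def coset (v : G) (α : Set G) : Set G := {x | v⁻¹ * x ∈ Subgroup.closure α}

/-- `G` together with the generator set `E` is a Cayley group: every element of `E`
is a non-trivial involution and `E` generates `G`. -/
def IsCayley (E : Set G) : Prop :=
  (∀ e ∈ E, e ≠ 1 ∧ e * e = 1) ∧ Subgroup.closure E = ⊤

/-- A coset cycle of length `m` in the Cayley group `G` with generator set `E`. -/
def IsCosetCycle (E : Set G) (m : ℕ) (v : ZMod m → G) (α : ZMod m → Set G) : Prop :=
  (∀ i, α i ⊆ E) ∧
  (∀ i, (v i)⁻¹ * v (i + 1) ∈ Subgroup.closure (α i)) ∧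
  (∀ i, coset (v i) (α (i - 1) ∩ α i) ∩ coset (v (i + 1)) (α i ∩ α (i + 1)) = ∅)

/-- Coset `n`-acyclic: no coset cycle of length `≤ n`. -/
def CosetAcyclic (E : Set G) (n : ℕ) : Prop :=
  ∀ m, 1 ≤ m → m ≤ n → ∀ (v : ZMod m → G) (α : ZMod m → Set G), ¬ IsCosetCycle E m v α

/-- 2-acyclic: no coset cycle of length 2. -/
def TwoAcyclic (E : Set G) : Prop :=
  ∀ (v : ZMod 2 → G) (α : ZMod 2 → Set G), ¬ IsCosetCycle E 2 v α

/-- Labels of a path of length `ℓ`, where labels with indices outside `1..ℓ` equal `∅`. -/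
def extLabel (ℓ : ℕ) (α : ℕ → Set G) (i : ℕ) : Set G :=
  if 1 ≤ i ∧ i ≤ ℓ then α i else ∅

/-- A coset path of length `ℓ ≥ 1` with vertices `v 1, …, v (ℓ+1)` and labels
`α 1, …, α ℓ` (vertices pairwise distinct except possibly `v 1 = v (ℓ+1)`;
convention `α 0 = α (ℓ+1) = ∅`). -/
def IsCosetPath (E : Set G) (ℓ : ℕ) (v : ℕ → G) (α : ℕ → Set G) : Prop :=
  1 ≤ ℓ ∧
  (∀ i, 1 ≤ i → i ≤ ℓ → α i ⊆ E) ∧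
  (∀ i j, 1 ≤ i → i < j → j ≤ ℓ + 1 → v i = v j → i = 1 ∧ j = ℓ + 1) ∧
  (∀ i, 1 ≤ i → i ≤ ℓ → (v i)⁻¹ * v (i + 1) ∈ Subgroup.closure (α i)) ∧
  (∀ i, 1 ≤ i → i ≤ ℓ →
    coset (v i) (extLabel ℓ α (i - 1) ∩ α i) ∩
      coset (v (i + 1)) (α i ∩ extLabel ℓ α (i + 1)) = ∅)

/-- `γ` is the unique minimal generator set connecting `v` and `u`:
for every `β ⊆ E`, `u ∈ [v]_β` iff `γ ⊆ β`. -/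
def IsGen (E : Set G) (v u : G) (γ : Set G) : Prop :=
  γ ⊆ E ∧ ∀ β ⊆ E, (u ∈ coset v β ↔ γ ⊆ β)

/-- The dual hyperedge `⟦v⟧`: all label-tagged cosets `(α, [v]_α)` for `α ⊆ E`. -/
def dedge (E : Set G) (v : G) : Set (Set G × Set G) :=
  {p | p.1 ⊆ E ∧ p.2 = coset v p.1}

/-- The vertex set of the dual hypergraph: all label-tagged cosets. -/
def dualV (E : Set G) : Set (Set G × Set G) :=
  {p | p.1 ⊆ E ∧ ∃ v : G, p.2 = coset v p.1}

/-- Gaifman adjacency in the dual hypergraph: two distinct vertices lying in a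
common hyperedge. -/
def dAdj (E : Set G) (x y : Set G × Set G) : Prop :=
  x ≠ y ∧ ∃ w : G, x ∈ dedge E w ∧ y ∈ dedge E w

/-- `ρ(v,γ) = { (β, [v]_β) : γ ⊆ β ⊆ E }`. -/
def rho (E : Set G) (v : G) (γ : Set G) : Set (Set G × Set G) :=
  {p | γ ⊆ p.1 ∧ p.1 ⊆ E ∧ p.2 = coset v p.1}

/-- A non-`t` coset path for `t = ρ(w,γ)`: a coset path all of whose links `[v_i]_{α_i}`
fail to contain `[w]_γ`. -/
def IsNonTPath (E : Set G) (w : G) (γ : Set G) (ℓ : ℕ) (v : ℕ → G) (α : ℕ → Set G) : Prop :=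
  IsCosetPath E ℓ v α ∧ ∀ i, 1 ≤ i → i ≤ ℓ → ¬ coset w γ ⊆ coset (v i) (α i)

/-- An inner coset path with respect to `g = gen(v 1, v (ℓ+1))`. -/
def IsInnerPath (E : Set G) (g : Set G) (ℓ : ℕ) (v : ℕ → G) (α : ℕ → Set G) : Prop :=
  IsCosetPath E ℓ v α ∧ 2 ≤ ℓ ∧
    ∀ i, 1 ≤ i → i ≤ ℓ → coset (v i) (α i) ⊂ coset (v 1) g

/-- A non-trivial coset path with respect to `g = gen(v 1, v (ℓ+1))`. -/
def IsNontrivialPath (E : Set G) (g : Set G) (ℓ : ℕ) (v : ℕ → G) (α : ℕ → Set G) : Prop :=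
  IsCosetPath E ℓ v α ∧ 2 ≤ ℓ ∧
    ∀ i, 1 ≤ i → i ≤ ℓ → ¬ coset (v 1) g ⊆ coset (v i) (α i)

/-- `n`-conformality of the dual hypergraph: every Gaifman clique of size `≤ n`
is contained in a hyperedge. -/
def NConformal (E : Set G) (n : ℕ) : Prop :=
  ∀ K : Finset (Set G × Set G), K.card ≤ n → (↑K : Set (Set G × Set G)) ⊆ dualV E →
    (∀ x ∈ K, ∀ y ∈ K, x ≠ y → dAdj E x y) → ∃ w : G, ∀ x ∈ K, x ∈ dedge E w

/-- `n`-chordality of the dual hypergraph: every Gaifman cycle of length `> 3`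
and `≤ n` has a chord. -/
def NChordal (E : Set G) (n : ℕ) : Prop :=
  ∀ m, 4 ≤ m → m ≤ n → ∀ c : ZMod m → Set G × Set G, Function.Injective c →
    (∀ i, c i ∈ dualV E) → (∀ i, dAdj E (c i) (c (i + 1))) →
    ∃ i j : ZMod m, i ≠ j ∧ j ≠ i + 1 ∧ i ≠ j + 1 ∧ dAdj E (c i) (c j)

/-- A walk of length `k` in the Gaifman graph of the dual hypergraph restricted to
the complement of `t = ρ(v,γ)`, from a vertex of `⟦v⟧ \ t` to a vertex of `⟦u⟧ \ t`. -/
def HWalk (E : Set G) (v : G) (γ : Set G) (u : G) (k : ℕ) (c : ℕ → Set G × Set G) : Prop :=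
  c 0 ∈ dedge E v ∧ c k ∈ dedge E u ∧
  (∀ i ≤ k, c i ∈ dualV E ∧ c i ∉ rho E v γ) ∧
  ∀ i < k, dAdj E (c i) (c (i + 1))

/-- The sequence of dual-hypergraph vertices induced by a coset path:
`(∅,[v 1]_∅), (α 1, [v 2]_{α 1}), …, (α ℓ, [v (ℓ+1)]_{α ℓ}), (∅, [v (ℓ+1)]_∅)`. -/
def pathVert (ℓ : ℕ) (v : ℕ → G) (α : ℕ → Set G) (i : ℕ) : Set G × Set G :=
  if i = 0 then (∅, coset (v 1) ∅)
  else if i ≤ ℓ then (α i, coset (v (i + 1)) (α i))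
  else (∅, coset (v (ℓ + 1)) ∅)

end CayleyDefs


open Subgroup in
theorem mem_coset_trans {G : Type*} [Group G] {x y z : G} {β γ δ : Set G}
    (hxy : y ∈ coset x β) (hyz : z ∈ coset y γ) (hβ : β ⊆ δ) (hγ : γ ⊆ δ) : z ∈ coset x δ := by
  have := mul_mem (closure_mono hβ hxy) (closure_mono hγ hyz)
  simpa [coset, mul_assoc] using this

open Subgroup in
theorem mem_coset_comm {G : Type*} [Group G] {x y : G} {β : Set G} :
    y ∈ coset x β ↔ x ∈ coset y β := by
  simp only [coset, Set.mem_ofPred_eq]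
  rw [← inv_mem_iff (x := x⁻¹ * y)]
  simp

theorem mem_coset_self {G : Type*} [Group G] (x : G) (β : Set G) : x ∈ coset x β := by
  simp [coset]

/-- A coset acyclic group has no periodic coset path of small period. -/
theorem CosetAcyclic.not_periodic {G : Type*} [Group G] {E : Set G} {N m : ℕ}
    (h : CosetAcyclic E N) (hm : 1 ≤ m) (hmN : m ≤ N) {u : ℕ → G} {γ : ℕ → Set G}
    (hu : Function.Periodic u m) (hγ : Function.Periodic γ m) (hE : ∀ p < m, γ p ⊆ E)
    (hlink : ∀ p < m, u (p + 1) ∈ coset (u p) (γ p))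
    (hdis : ∀ p < m, coset (u (p + 1)) (γ p ∩ γ (p + 1)) ∩
      coset (u (p + 2)) (γ (p + 1) ∩ γ (p + 2)) = ∅) : False := by
  have : NeZero m := ⟨by omega⟩
  have hu' (k : ℕ) : u (k : ZMod m).val = u k := by
    rw [ZMod.val_natCast]; exact hu.map_mod_nat k
  have hγ' (k : ℕ) : γ (k : ZMod m).val = γ k := by
    rw [ZMod.val_natCast]; exact hγ.map_mod_nat k
  refine h m hm hmN (fun i => u i.val) (fun i => γ i.val)
    ⟨fun i => hE _ (ZMod.val_lt i), fun i => ?_, fun i => ?_⟩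
  · have hi := hlink i.val (ZMod.val_lt i)
    rwa [← hu' (i.val + 1), Nat.cast_add, ZMod.natCast_zmod_val, Nat.cast_one] at hi
  · have hi := hdis (i - 1).val (ZMod.val_lt _)
    rw [← hu' ((i - 1).val + 1), ← hu' ((i - 1).val + 2), ← hγ' ((i - 1).val + 1),
      ← hγ' ((i - 1).val + 2), Nat.cast_add, Nat.cast_add, ZMod.natCast_zmod_val, Nat.cast_one,
      Nat.cast_ofNat, sub_add_cancel, show i - 1 + 2 = i + 1 by ring] at hi
    exact hi

/-- A short closed chain `y, α a, v (a+1), …, v b, α b, y` whose inner links satisfy the coset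
path condition must violate it at one of the two links incident with `y`. -/
theorem CosetAcyclic.closed_chain {G : Type*} [Group G] {E : Set G} {N a b : ℕ}
    (h : CosetAcyclic E N) (hab : a < b) (hN : b - a + 1 ≤ N) {v : ℕ → G} {α : ℕ → Set G} {y : G}
    (hE : ∀ j, a ≤ j → j ≤ b → α j ⊆ E)
    (hfirst : v (a + 1) ∈ coset y (α a))
    (hlink : ∀ j, a < j → j < b → v (j + 1) ∈ coset (v j) (α j))
    (hlast : y ∈ coset (v b) (α b))
    (hdis : ∀ j, a < j → j < b →
      coset (v j) (α (j - 1) ∩ α j) ∩ coset (v (j + 1)) (α j ∩ α (j + 1)) = ∅) :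
    (∃ z, z ∈ coset y (α b ∩ α a) ∧ z ∈ coset (v (a + 1)) (α a ∩ α (a + 1))) ∨
      ∃ z, z ∈ coset (v b) (α (b - 1) ∩ α b) ∧ z ∈ coset y (α b ∩ α a) := by
  by_contra! ⟨hleft, hright⟩
  obtain ⟨d, rfl⟩ : ∃ d, b = a + 1 + d := ⟨b - a - 1, by omega⟩
  set u : ℕ → G := fun j => if j % (d + 2) = 0 then y else v (a + j % (d + 2)) with hu
  set γ : ℕ → Set G := fun j => α (a + j % (d + 2)) with hγ
  have u_zero : u 0 = y := by simp [hu]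
  have u_per : Function.Periodic u (d + 2) := fun j => by simp [hu]
  have γ_per : Function.Periodic γ (d + 2) := fun j => by simp [hγ]
  have u_of {j : ℕ} (h0 : 0 < j) (hj : j < d + 2) : u j = v (a + j) := by
    simp [hu, Nat.mod_eq_of_lt hj, h0.ne']
  have γ_of {j : ℕ} (hj : j < d + 2) : γ j = α (a + j) := by
    simp [hγ, Nat.mod_eq_of_lt hj]
  have u_last : u (d + 2) = y := by simpa [u_zero] using u_per 0
  have γ_last : γ (d + 2) = α a := by simpa [γ_of] using γ_per 0
  have u_succ : u (d + 3) = v (a + 1) := by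
    rw [show d + 3 = 1 + (d + 2) by ring, u_per, u_of (by omega) (by omega)]
  have γ_succ : γ (d + 3) = α (a + 1) := by
    rw [show d + 3 = 1 + (d + 2) by ring, γ_per, γ_of (by omega)]
  refine h.not_periodic (m := d + 2) (by omega) (by omega) u_per γ_per ?_ ?_ ?_
  · intro p hp
    rw [γ_of hp]
    exact hE _ (by omega) (by omega)
  · intro p hp
    rw [γ_of hp]
    rcases Nat.eq_zero_or_pos p with rfl | hp0
    · rw [u_zero, u_of (by omega) (by omega)]
      exact hfirst
    · rw [u_of hp0 hp]
      rcases Nat.lt_or_ge (p + 1) (d + 2) with hp1 | hp1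
      · rw [u_of (by omega) hp1]
        exact hlink _ (by omega) (by omega)
      · obtain rfl : p = d + 1 := by omega
        rw [u_last, show a + (d + 1) = a + 1 + d by ring]
        exact hlast
  · intro p hp
    rw [γ_of hp]
    rcases Nat.lt_or_ge (p + 2) (d + 2) with hp2 | hp2
    · rw [u_of (by omega) (by omega), u_of (by omega) hp2, γ_of (by omega), γ_of hp2]
      exact hdis (a + (p + 1)) (by omega) (by omega)
    · rw [Set.eq_empty_iff_forall_notMem]
      rintro z ⟨hz1, hz2⟩
      rcases Nat.lt_or_ge p (d + 1) with hpd | hpd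
      · obtain rfl : p = d := by omega
        rw [u_of (by omega) (by omega), γ_of (by omega)] at hz1
        rw [u_last, γ_of (by omega), γ_last] at hz2
        rw [show a + (p + 1) = a + 1 + p by ring] at hz1 hz2
        exact hright z (by rwa [show a + 1 + p - 1 = a + p by omega]) hz2
      · obtain rfl : p = d + 1 := by omega
        rw [u_last, γ_last, show a + (d + 1) = a + 1 + d by ring] at hz1
        rw [u_succ, γ_last, γ_succ] at hz2
        exact hleft z hz1 hz2

/-- In a coset 2-acyclic group, cosets of a common element intersect in the coset of the
intersection of their labels. -/
theorem CosetAcyclic.mem_coset_inter {G : Type*} [Group G] {E : Set G} {N : ℕ}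
    (h : CosetAcyclic E N) (hN : 2 ≤ N) {β γ : Set G} (hβE : β ⊆ E) (hγE : γ ⊆ E) {x y : G}
    (hβ : y ∈ coset x β) (hγ : y ∈ coset x γ) : y ∈ coset x (β ∩ γ) := by
  have key := h.closed_chain (a := 0) (b := 1) (v := fun _ => x) (y := y)
    (α := fun j => if j = 0 then β else γ) (by omega) (by omega)
    (by intro j _ _; split_ifs <;> assumption) (by simpa using mem_coset_comm.1 hβ)
    (fun j _ _ => by omega) (by simpa using hγ) (fun j _ _ => by omega)
  rcases key with ⟨z, hz1, hz2⟩ | ⟨z, hz2, hz1⟩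
  all_goals
    exact mem_coset_trans hz2 (mem_coset_comm.1 hz1) (by simp)
      (by simp [Set.inter_comm])

/-- There is no short closed chain `y, α a, v (a+1), …, v b, α b, y` with at least three links
whose inner links satisfy the coset path condition. -/
theorem CosetAcyclic.no_closed_chain {G : Type*} [Group G] {E : Set G} {N : ℕ}
    (h : CosetAcyclic E N) {v : ℕ → G} {α : ℕ → Set G} (d a : ℕ) (y : G) (hN : d + 3 ≤ N)
    (hE : ∀ j, a ≤ j → j ≤ a + 2 + d → α j ⊆ E)
    (hfirst : v (a + 1) ∈ coset y (α a))
    (hlink : ∀ j, a < j → j < a + 2 + d → v (j + 1) ∈ coset (v j) (α j))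
    (hlast : y ∈ coset (v (a + 2 + d)) (α (a + 2 + d)))
    (hdis : ∀ j, a < j → j < a + 2 + d →
      coset (v j) (α (j - 1) ∩ α j) ∩ coset (v (j + 1)) (α j ∩ α (j + 1)) = ∅) : False := by
  induction d generalizing a y with
  | zero =>
    have hd : ∀ z, z ∈ coset (v (a + 1)) (α a ∩ α (a + 1)) →
        z ∉ coset (v (a + 2)) (α (a + 1) ∩ α (a + 2)) := fun z h1 h2 =>
      (Set.eq_empty_iff_forall_notMem.1 (hdis (a + 1) (by omega) (by omega)) z) ⟨h1, h2⟩
    have hmid := hlink (a + 1) (by omega) (by omega)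
    have hE0 := hE a (by omega) (by omega)
    have hE1 := hE (a + 1) (by omega) (by omega)
    have hE2 := hE (a + 2) (by omega) (by omega)
    rcases h.closed_chain (by omega) (by omega) hE hfirst hlink hlast hdis with
      ⟨z, hz1, hz2⟩ | ⟨z, hz2, hz1⟩
    · refine hd z hz2 (h.mem_coset_inter (by omega) hE1 hE2 ?_ ?_)
      · exact mem_coset_trans (mem_coset_comm.1 hmid) hz2 subset_rfl Set.inter_subset_right
      · exact mem_coset_trans hlast hz1 subset_rfl Set.inter_subset_left
    · refine hd z (h.mem_coset_inter (by omega) hE0 hE1 ?_ ?_) hz2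
      · exact mem_coset_trans (mem_coset_comm.1 hfirst) hz1 subset_rfl Set.inter_subset_right
      · exact mem_coset_trans hmid hz2 subset_rfl Set.inter_subset_left
  | succ d ih =>
    rcases h.closed_chain (by omega) (by omega) hE hfirst hlink hlast hdis with
      ⟨z, hz1, hz2⟩ | ⟨z, hz2, hz1⟩
    · have hb : a + 1 + 2 + d = a + 2 + (d + 1) := by ring
      refine ih (a + 1) z (by omega) (fun j _ _ => hE j (by omega) (by omega)) ?_
        (fun j _ _ => hlink j (by omega) (by omega)) ?_
        (fun j _ _ => hdis j (by omega) (by omega))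
      · exact mem_coset_trans (mem_coset_comm.1 hz2) (hlink (a + 1) (by omega) (by omega))
          Set.inter_subset_right subset_rfl
      · rw [hb]
        exact mem_coset_trans hlast hz1 subset_rfl Set.inter_subset_left
    · refine ih a z (by omega) (fun j _ _ => hE j (by omega) (by omega)) ?_
        (fun j _ _ => hlink j (by omega) (by omega)) ?_
        (fun j _ _ => hdis j (by omega) (by omega))
      · exact mem_coset_trans (mem_coset_comm.1 hz1) hfirst Set.inter_subset_right subset_rfl
      · exact mem_coset_trans (hlink (a + 2 + d) (by omega) (by omega)) hz2 subset_rfl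
          Set.inter_subset_left

/-- in a coset `2n`-acyclic Cayley group, if a coset path
`v_1, α_1, …, α_ℓ, v_{ℓ+1}` has a link with `[v_1]_{gen(v_1,v_{ℓ+1})} ∩ [v_i]_{α_{i-1} ∩ α_i} = ∅`
for some `2 ≤ i ≤ ℓ`, then `ℓ > n`. -/
theorem long_on_the_outside {G : Type*} [Group G] (n : ℕ) (E : Set G) (hC : IsCayley E)
    (hacyc : CosetAcyclic E (2 * n)) (ℓ : ℕ)
    (vs : ℕ → G) (α : ℕ → Set G) (hp : IsCosetPath E ℓ vs α)
    (g : Set G) (hg : IsGen E (vs 1) (vs (ℓ + 1)) g)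
    (i : ℕ) (hi2 : 2 ≤ i) (hiℓ : i ≤ ℓ)
    (hdisj : coset (vs 1) g ∩ coset (vs i) (α (i - 1) ∩ α i) = ∅) :
    n < ℓ := by
  obtain ⟨-, hE, -, hlink, hdis⟩ := hp
  have hmem (j : ℕ) (h1 : 1 ≤ j) (hj : j ≤ ℓ) : vs (j + 1) ∈ coset (vs j) (α j) := hlink j h1 hj
  have hend : vs (ℓ + 1) ∈ coset (vs 1) g := (hg.2 g hg.1).2 subset_rfl
  by_contra! hle
  have ext_of {j : ℕ} (h1 : 1 ≤ j) (hj : j ≤ ℓ) : extLabel ℓ α j = α j := by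
    simp [extLabel, h1, hj]
  let meets (j : ℕ) : Prop :=
    ∃ w ∈ coset (vs 1) g, w ∈ coset (vs j) (α (j - 1) ∩ extLabel ℓ α j)
  have hnot : ¬ meets i := fun ⟨w, hw1, hw2⟩ => by
    rw [ext_of (by omega) hiℓ] at hw2
    exact Set.eq_empty_iff_forall_notMem.1 hdisj w ⟨hw1, hw2⟩
  obtain ⟨k, hik, hkℓ, hk, w, hwg, hw⟩ :
      ∃ k, i ≤ k ∧ k ≤ ℓ ∧ ¬ meets k ∧ meets (k + 1) := by
    by_contra! hcon
    have hall (j : ℕ) (hj : i ≤ j) : j ≤ ℓ + 1 → ¬ meets j := by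
      induction j, hj using Nat.le_induction with
      | base => exact fun _ => hnot
      | succ j hj ih => exact fun hjℓ => hcon j hj (by omega) (ih (by omega))
    exact hall (ℓ + 1) (by omega) le_rfl ⟨_, hend, mem_coset_self _ _⟩
  obtain ⟨d, rfl⟩ : ∃ d, k = d + 2 := ⟨k - 2, by omega⟩
  rw [Nat.add_sub_cancel] at hw
  have hb : 1 + 2 + d = d + 2 + 1 := by ring
  refine hacyc.no_closed_chain (v := fun j => if j = d + 3 then w else vs j)
    (α := fun j => if j = d + 3 then g else α j) d 1 (vs 1) (by omega) ?_ ?_ ?_ ?_ ?_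
  · intro j h1 h2
    split_ifs with hj
    · exact hg.1
    · exact hE j h1 (by omega)
  · simpa using hmem 1 le_rfl (by omega)
  · intro j h1 h2
    rcases Nat.lt_or_ge j (d + 2) with hj | hj
    · simpa [show j ≠ d + 3 by omega, show j ≠ d + 2 by omega] using hmem j (by omega) (by omega)
    · obtain rfl : j = d + 2 := by omega
      simpa using mem_coset_trans (hmem (d + 2) (by omega) hkℓ) hw subset_rfl
        Set.inter_subset_left
  · simpa [hb] using mem_coset_comm.1 hwg
  · intro j h1 h2
    have hj1 : j - 1 ≠ d + 3 := by omega
    rcases Nat.lt_or_ge j (d + 2) with hj | hj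
    · have := hdis j (by omega) (by omega)
      rw [ext_of (by omega) (by omega), ext_of (by omega) (by omega)] at this
      simpa [show j ≠ d + 3 by omega, show j ≠ d + 2 by omega, hj1] using this
    · obtain rfl : j = d + 2 := by omega
      simp only [hj1, if_false, if_true, show d + 2 ≠ d + 3 by omega]
      rw [Set.eq_empty_iff_forall_notMem]
      rintro z ⟨hz1, hz2⟩
      refine hk ⟨z, mem_coset_trans hwg hz2 subset_rfl Set.inter_subset_right, ?_⟩
      rwa [ext_of (by omega) hkℓ]
end

section
/- For every m ∈ ℕ there exists n ∈ ℕ such that: for every coset n-acyclic Cayley group G with generator set E and all vertices v ≠ u in G, if there is no inner coset path from v to u of length ≤ m, then there is no non-trivial coset path from v to u of length ≤ m, i.e. d(v,u) > m. -/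
open scoped Pointwise

universe u

section CosetWalks

variable {G : Type*} [Group G]

theorem Subgroup.inv_mul_mem_trans (H : Subgroup G) {x y z : G} (hxy : x⁻¹ * y ∈ H)
    (hyz : y⁻¹ * z ∈ H) : x⁻¹ * z ∈ H := by
  simpa [mul_assoc] using H.mul_mem hxy hyz

theorem Subgroup.inv_mul_mem_symm (H : Subgroup G) {x y : G} (hxy : x⁻¹ * y ∈ H) :
    y⁻¹ * x ∈ H := by
  simpa using H.inv_mem hxy

theorem mem_coset {v x : G} {α : Set G} : x ∈ coset v α ↔ v⁻¹ * x ∈ Subgroup.closure α :=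
  Iff.rfl

theorem coset_subset_coset {x y : G} {α β : Set G} (hαβ : α ⊆ β)
    (hxy : x⁻¹ * y ∈ Subgroup.closure β) : coset y α ⊆ coset x β := fun _ hz =>
  Subgroup.inv_mul_mem_trans _ hxy (Subgroup.closure_mono hαβ hz)

/-- A walk `p 0, a 0, p 1, …, a (ℓ - 1), p ℓ` in which `p (i + 1)` lies in the `a i`-coset of
`p i` and every link satisfies `P`. -/
def IsLinkWalk (P : G → Set G → Prop) (ℓ : ℕ) (p : ℕ → G) (a : ℕ → Set G) : Prop :=
  ∀ i < ℓ, P (p i) (a i) ∧ (p i)⁻¹ * p (i + 1) ∈ Subgroup.closure (a i)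

/-- The vertices `x` and `y` are joined by a walk of length `ℓ` with links satisfying `P`. -/
def LinkConnected (P : G → Set G → Prop) (ℓ : ℕ) (x y : G) : Prop :=
  ∃ p a, IsLinkWalk P ℓ p a ∧ p 0 = x ∧ p ℓ = y

namespace LinkConnected

variable {P : G → Set G → Prop} {ℓ : ℕ} {x y z : G} {b : Set G}

theorem single (hP : P x b) (hxy : x⁻¹ * y ∈ Subgroup.closure b) : LinkConnected P 1 x y := by
  refine ⟨fun i => if i = 0 then x else y, fun _ => b, fun i hi => ?_, by simp, by simp⟩
  obtain rfl : i = 0 := by omega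
  simpa using ⟨hP, hxy⟩

theorem trans {k : ℕ} (h₁ : LinkConnected P k x y) (h₂ : LinkConnected P ℓ y z) :
    LinkConnected P (k + ℓ) x z := by
  obtain ⟨p, a, hp, rfl, rfl⟩ := h₁
  obtain ⟨q, b, hq, hq0, rfl⟩ := h₂
  refine ⟨fun i => if i < k then p i else q (i - k), fun i => if i < k then a i else b (i - k),
    fun i hi => ?_, ?_, by simp⟩
  · rcases lt_trichotomy (i + 1) k with h | h | h
    · simpa [h, show i < k by omega] using hp i (by omega)
    · subst h
      simpa [hq0] using hp i (by omega)
    · have := hq (i - k) (by omega)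
      simpa [show ¬ i < k by omega, show ¬ i + 1 < k by omega,
        show i + 1 - k = i - k + 1 by omega] using this
  · rcases Nat.eq_zero_or_pos k with rfl | h
    · simpa using hq0
    · simp [h]

end LinkConnected

theorem IsLinkWalk.linkConnected_take {P : G → Set G → Prop} {ℓ : ℕ} {p : ℕ → G} {a : ℕ → Set G}
    (h : IsLinkWalk P ℓ p a) {i : ℕ} (hi : i ≤ ℓ) : LinkConnected P i (p 0) (p i) :=
  ⟨p, a, fun j hj => h j (by omega), rfl, rfl⟩

theorem IsLinkWalk.linkConnected_drop {P : G → Set G → Prop} {ℓ : ℕ} {p : ℕ → G} {a : ℕ → Set G}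
    (h : IsLinkWalk P ℓ p a) {i : ℕ} (hi : i ≤ ℓ) : LinkConnected P (ℓ - i) (p i) (p ℓ) :=
  ⟨fun j => p (i + j), fun j => a (i + j), fun j hj => h (i + j) (by omega), rfl,
    by simp [Nat.add_sub_cancel' hi]⟩

/-- Link `k` of a walk can be removed if some `w` lies in the cosets of both neighbouring links. -/
theorem IsLinkWalk.linkConnected_bypass {P : G → Set G → Prop}
    (hP : ∀ x y b, x⁻¹ * y ∈ Subgroup.closure b → P x b → P y b) {ℓ : ℕ} {p : ℕ → G}
    {a : ℕ → Set G} (h : IsLinkWalk P ℓ p a) {k : ℕ} (hk : k < ℓ) {w : G}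
    (hl : 0 < k → (p k)⁻¹ * w ∈ Subgroup.closure (a (k - 1)))
    (hr : k + 1 < ℓ → (p (k + 1))⁻¹ * w ∈ Subgroup.closure (a (k + 1))) :
    LinkConnected P (ℓ - 1) (if k = 0 then w else p 0) (if k + 1 = ℓ then w else p ℓ) := by
  have h₁ : LinkConnected P k (if k = 0 then w else p 0) w := by
    rcases Nat.eq_zero_or_pos k with rfl | h0
    · exact ⟨fun _ => w, a, fun i hi => by omega, by simp, rfl⟩
    · have hs := h (k - 1) (by omega)
      rw [Nat.sub_add_cancel h0] at hs
      have := (h.linkConnected_take (i := k - 1) (by omega)).trans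
        (.single hs.1 (Subgroup.inv_mul_mem_trans _ hs.2 (hl h0)))
      rwa [Nat.sub_add_cancel h0, ← if_neg (c := k = 0) (t := w) (e := p 0) h0.ne'] at this
  have h₂ : LinkConnected P (ℓ - 1 - k) w (if k + 1 = ℓ then w else p ℓ) := by
    by_cases h0 : k + 1 = ℓ
    · rw [if_pos h0, show ℓ - 1 - k = 0 by omega]
      exact ⟨fun _ => w, a, fun i hi => by omega, rfl, rfl⟩
    · rw [if_neg h0]
      have hs := h (k + 1) (by omega)
      have hw := hr (by omega)
      have := LinkConnected.trans (.single (hP _ _ _ hw hs.1)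
        (Subgroup.inv_mul_mem_trans _ (Subgroup.inv_mul_mem_symm _ hw) hs.2))
        (h.linkConnected_drop (i := k + 1 + 1) (by omega))
      rwa [show 1 + (ℓ - (k + 1 + 1)) = ℓ - 1 - k by omega] at this
  have := h₁.trans h₂
  rwa [show k + (ℓ - 1 - k) = ℓ - 1 by omega] at this

/-- In a coset acyclic group every short closed walk has a link whose two transition cosets
meet. -/
theorem CosetAcyclic.exists_mem_inter {E : Set G} {n : ℕ} (hE : CosetAcyclic E n) {ℓ : ℕ}
    (hn : ℓ + 1 ≤ n) {p : ℕ → G} {a : ℕ → Set G} (ha : ∀ i ≤ ℓ, a i ⊆ E)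
    (hp : ∀ i < ℓ, (p i)⁻¹ * p (i + 1) ∈ Subgroup.closure (a i))
    (hc : (p ℓ)⁻¹ * p 0 ∈ Subgroup.closure (a ℓ)) :
    ∃ k ≤ ℓ, ∃ w, w ∈ coset (p k) (a (if k = 0 then ℓ else k - 1) ∩ a k) ∧
      w ∈ coset (p (if k = ℓ then 0 else k + 1)) (a k ∩ a (if k = ℓ then 0 else k + 1)) := by
  by_contra! hcon
  have hsucc (i : Fin (ℓ + 1)) : (i + 1).val = if i.val = ℓ then 0 else i.val + 1 := by
    rw [Fin.val_add_one]
    simp [Fin.ext_iff]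
  have hpred (i : Fin (ℓ + 1)) : (i - 1).val = if i.val = 0 then ℓ else i.val - 1 := by
    have h := hsucc (i - 1)
    rw [sub_add_cancel] at h
    have := (i - 1).isLt
    split_ifs at h ⊢ <;> omega
  refine hE (ℓ + 1) (by omega) hn (fun i : Fin (ℓ + 1) => p i.val)
    (fun i : Fin (ℓ + 1) => a i.val) ⟨fun i => ha _ (Fin.is_le i),
      fun (i : Fin (ℓ + 1)) => ?_, fun (i : Fin (ℓ + 1)) => ?_⟩
  · change (p i.val)⁻¹ * p (i + 1).val ∈ Subgroup.closure (a i.val)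
    have hi : i.val ≤ ℓ := i.is_le
    rw [hsucc i]
    split_ifs with h
    · rw [h]
      exact hc
    · exact hp _ (by omega)
  · rw [Set.eq_empty_iff_forall_notMem]
    rintro w ⟨h₁, h₂⟩
    refine hcon i.val i.is_le w ?_ ?_
    · rw [← hpred i]
      exact h₁
    · rw [← hsucc i]
      exact h₂

/-- A walk between two vertices of a `g`-coset whose links do not contain this coset can be
replaced by a walk that is not longer and whose labels are proper subsets of `g`. -/
theorem CosetAcyclic.exists_linkConnected_ssubset {E : Set G} {n : ℕ} (hE : CosetAcyclic E n)
    {g : Set G} (hg : g ⊆ E) {v : G} {ℓ : ℕ} (hn : ℓ + 1 ≤ n) {x y : G} (hx : x ∈ coset v g)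
    (hy : y ∈ coset v g)
    (h : LinkConnected (fun z b => b ⊆ E ∧ ¬ coset v g ⊆ coset z b) ℓ x y) :
    ∃ k ≤ ℓ, LinkConnected (fun _ b => b ⊂ g) k x y := by
  induction ℓ generalizing x y with
  | zero =>
    obtain ⟨p, a, -, rfl, rfl⟩ := h
    exact ⟨0, le_rfl, p, a, fun i hi => by omega, rfl, rfl⟩
  | succ ℓ ih =>
    obtain ⟨p, a, hp, rfl, rfl⟩ := h
    have hss {z : G} {b : Set G} (hz : z ∈ coset v g) (hb : ¬ coset v g ⊆ coset z b) :
        g ∩ b ⊂ g :=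
      ⟨Set.inter_subset_left, fun hgb => hb <|
        coset_subset_coset (fun e he => (hgb he).2)
          (Subgroup.closure_mono (fun e he => (hgb he).2) (Subgroup.inv_mul_mem_symm _ hz))⟩
    have hfirst : g ∩ a 0 ⊂ g := hss hx (hp 0 (by omega)).1.2
    have hlast : g ∩ a ℓ ⊂ g := hss hy fun hsub => (hp ℓ (by omega)).1.2 <|
      hsub.trans (coset_subset_coset subset_rfl (hp ℓ (by omega)).2)
    obtain ⟨k, hk, w, hw₁, hw₂⟩ := hE.exists_mem_inter hn (p := p)
      (a := fun i => if i < ℓ + 1 then a i else g)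
      (fun i _ => by
        split_ifs with hi
        exacts [(hp i hi).1.1, hg])
      (fun i hi => by simpa [hi] using (hp i hi).2)
      (by simpa using Subgroup.inv_mul_mem_trans _ (Subgroup.inv_mul_mem_symm _ hy) hx)
    rcases hk.eq_or_lt with rfl | hk
    · simp only [Nat.add_eq_zero_iff, one_ne_zero, and_false, if_false, add_tsub_cancel_right,
        Nat.lt_succ_self, lt_irrefl, if_true, Nat.succ_pos] at hw₁ hw₂
      rw [Set.inter_comm] at hw₁
      rcases Nat.eq_zero_or_pos ℓ with rfl | hℓ
      · exact ⟨1, le_rfl, .single hfirst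
          (Subgroup.inv_mul_mem_trans _ hw₂ (Subgroup.inv_mul_mem_symm _ hw₁))⟩
      · exact ⟨2, by omega, .trans (.single hfirst hw₂)
          (.single hlast (Subgroup.inv_mul_mem_symm _ hw₁))⟩
    · simp only [hk, hk.ne, if_true, if_false] at hw₁ hw₂
      have hmem₁ : k = 0 → (p 0)⁻¹ * w ∈ Subgroup.closure (g ∩ a 0) := by
        rintro rfl
        simpa [mem_coset] using hw₁
      have hmem₂ : k = ℓ → (p (ℓ + 1))⁻¹ * w ∈ Subgroup.closure (g ∩ a ℓ) := by
        rintro rfl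
        rw [Set.inter_comm]
        simpa [mem_coset] using hw₂
      by_cases hone : k = 0 ∧ k = ℓ
      · obtain ⟨rfl, rfl⟩ := hone
        exact ⟨1, le_rfl, .single hfirst
          (Subgroup.inv_mul_mem_trans _ (hmem₁ rfl) (Subgroup.inv_mul_mem_symm _ (hmem₂ rfl)))⟩
      have hby := hp.linkConnected_bypass
        (fun z t b hzt hz => ⟨hz.1, fun hsub => hz.2 (hsub.trans
          (coset_subset_coset subset_rfl hzt))⟩) hk (w := w)
        (fun h0 => by
          simp only [h0.ne', if_false, show k - 1 < ℓ + 1 by omega, if_true] at hw₁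
          exact Subgroup.closure_mono Set.inter_subset_left hw₁)
        (fun h0 => by
          simp only [h0, if_true] at hw₂
          exact Subgroup.closure_mono Set.inter_subset_right hw₂)
      simp only [Nat.add_sub_cancel, Nat.add_right_cancel_iff] at hby
      have hinl (b : Set G) : Subgroup.closure (g ∩ b) ≤ Subgroup.closure g :=
        Subgroup.closure_mono Set.inter_subset_left
      by_cases h0 : k = 0
      · have h1 : k ≠ ℓ := fun h1 => hone ⟨h0, h1⟩
        rw [if_pos h0, if_neg h1] at hby
        obtain ⟨j, hj, hc⟩ := ih (by omega)
          (Subgroup.inv_mul_mem_trans _ hx (hinl _ (hmem₁ h0))) hy hby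
        exact ⟨1 + j, by omega, .trans (.single hfirst (hmem₁ h0)) hc⟩
      · rw [if_neg h0] at hby
        by_cases h1 : k = ℓ
        · rw [if_pos h1] at hby
          obtain ⟨j, hj, hc⟩ := ih (by omega) hx
            (Subgroup.inv_mul_mem_trans _ hy (hinl _ (hmem₂ h1))) hby
          exact ⟨j + 1, by omega, hc.trans
            (.single hlast (Subgroup.inv_mul_mem_symm _ (hmem₂ h1)))⟩
        · rw [if_neg h1] at hby
          obtain ⟨j, hj, hc⟩ := ih (by omega) hx hy hby
          exact ⟨j, by omega, hc⟩

/-- A shortest walk with labels properly contained in `gen(v,u)` is an inner coset path. -/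
theorem exists_isInnerPath_of_linkConnected {E g : Set G} {v u : G} (huv : v ≠ u)
    (hg : IsGen E v u g) {k : ℕ} (h : LinkConnected (fun _ b => b ⊂ g) k v u) :
    ∃ (ℓ : ℕ) (vs : ℕ → G) (α : ℕ → Set G),
      ℓ ≤ k ∧ IsInnerPath E g ℓ vs α ∧ vs 1 = v ∧ vs (ℓ + 1) = u := by
  classical
  have hex : ∃ k, LinkConnected (fun _ b => b ⊂ g) k v u := ⟨k, h⟩
  obtain ⟨ℓ, hℓ, hmin, hle⟩ : ∃ ℓ, LinkConnected (fun _ b => b ⊂ g) ℓ v u ∧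
      (∀ j < ℓ, ¬ LinkConnected (fun _ b => b ⊂ g) j v u) ∧ ℓ ≤ k :=
    ⟨Nat.find hex, Nat.find_spec hex, fun _ => Nat.find_min hex, Nat.find_min' hex h⟩
  obtain ⟨p, a, hp, rfl, rfl⟩ := hℓ
  have hnot {b : Set G} (hb : b ⊂ g) : ¬ (p 0)⁻¹ * p ℓ ∈ Subgroup.closure b := fun hmem =>
    hb.2 ((hg.2 b (hb.1.trans hg.1)).1 hmem)
  have h0 : ℓ ≠ 0 := by
    rintro rfl
    exact huv rfl
  have h1 : ℓ ≠ 1 := by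
    rintro rfl
    exact hnot (hp 0 one_pos).1 (hp 0 one_pos).2
  have hmem : ∀ i ≤ ℓ, (p 0)⁻¹ * p i ∈ Subgroup.closure g := by
    intro i
    induction i with
    | zero => simp
    | succ i ih => exact fun hi => Subgroup.inv_mul_mem_trans _ (ih (by omega)) <|
        Subgroup.closure_mono (hp i (by omega)).1.1 (hp i (by omega)).2
  refine ⟨ℓ, fun i => p (i - 1), fun i => a (i - 1), hle,
    ⟨⟨by omega, fun i hi hi' => (hp (i - 1) (by omega)).1.1.trans hg.1, ?_, ?_, ?_⟩, by omega, ?_⟩,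
    rfl, rfl⟩
  · intro i j hi hij hj heq
    have hc := (hp.linkConnected_take (i := i - 1) (by omega))
    rw [show p (i - 1) = p (j - 1) from heq] at hc
    exact (hmin _ (by omega) (hc.trans (hp.linkConnected_drop (i := j - 1) (by omega)))).elim
  · intro i hi hi'
    obtain ⟨i, rfl⟩ := Nat.exists_eq_add_of_le' hi
    exact (hp i (by omega)).2
  · intro i hi hi'
    obtain ⟨i, rfl⟩ := Nat.exists_eq_add_of_le' hi
    rw [Set.eq_empty_iff_forall_notMem]
    rintro w ⟨hw₁, hw₂⟩
    simp only [mem_coset, Nat.add_sub_cancel, extLabel] at hw₁ hw₂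
    have hby := hp.linkConnected_bypass (fun _ _ _ _ hb => hb) (k := i) (by omega) (w := w)
      (fun hpos => by
        rw [if_pos (by omega)] at hw₁
        exact Subgroup.closure_mono Set.inter_subset_left hw₁)
      (fun hlt => by
        rw [if_pos (by omega)] at hw₂
        exact Subgroup.closure_mono Set.inter_subset_right hw₂)
    have hs : (if i = 0 then w else p 0) = p 0 := by
      split_ifs with hi0
      · subst hi0
        simpa [inv_mul_eq_one, eq_comm (a := w)] using hw₁
      · rfl
    have ht : (if i + 1 = ℓ then w else p ℓ) = p ℓ := by
      split_ifs with hiℓ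
      · subst hiℓ
        simpa [inv_mul_eq_one, eq_comm (a := w)] using hw₂
      · rfl
    rw [hs, ht] at hby
    exact hmin _ (by omega) hby
  · intro i hi hi'
    have hb := (hp (i - 1) (by omega)).1
    refine ⟨coset_subset_coset hb.1 (hmem _ (by omega)), fun hsub => hnot hb ?_⟩
    have hv : p 0 ∈ coset (p (i - 1)) (a (i - 1)) := hsub (by simp [coset])
    have hu : p ℓ ∈ coset (p (i - 1)) (a (i - 1)) := hsub (hmem ℓ le_rfl)
    exact Subgroup.inv_mul_mem_trans _ (Subgroup.inv_mul_mem_symm _ hv) hu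

end CosetWalks

/-- for every `m` there is `n` such that in every coset `n`-acyclic Cayley
group, for distinct `v, u`: if there is no inner coset path from `v` to `u` of length `≤ m`,
then there is no non-trivial coset path from `v` to `u` of length `≤ m`, i.e. `d(v,u) > m`. -/
theorem no_short_nontrivial_of_no_short_inner (m : ℕ) :
    ∃ n : ℕ, ∀ (G : Type u) [Group G] (E : Set G), IsCayley E → CosetAcyclic E n →
      ∀ v u : G, v ≠ u → ∀ g : Set G, IsGen E v u g →
        (¬ ∃ (ℓ : ℕ) (vs : ℕ → G) (α : ℕ → Set G),
            ℓ ≤ m ∧ IsInnerPath E g ℓ vs α ∧ vs 1 = v ∧ vs (ℓ + 1) = u) →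
        ¬ ∃ (ℓ : ℕ) (vs : ℕ → G) (α : ℕ → Set G),
            ℓ ≤ m ∧ IsNontrivialPath E g ℓ vs α ∧ vs 1 = v ∧ vs (ℓ + 1) = u := by
  refine ⟨m + 1, fun G _ E _ hE v u huv g hg hinner => ?_⟩
  rintro ⟨ℓ, vs, α, hℓ, ⟨⟨-, hα, -, hstep, -⟩, -, hnt⟩, rfl, rfl⟩
  obtain ⟨k, hk, hc⟩ := hE.exists_linkConnected_ssubset hg.1 (v := vs 1) (ℓ := ℓ) (by omega)
    (x := vs 1) (y := vs (ℓ + 1)) (by simp [coset]) ((hg.2 g hg.1).2 subset_rfl)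
    ⟨fun i => vs (i + 1), fun i => α (i + 1), fun i hi =>
      ⟨⟨hα _ (by omega) (by omega), hnt _ (by omega) (by omega)⟩,
        hstep _ (by omega) (by omega)⟩, rfl, rfl⟩
  obtain ⟨j, ws, β, hj, hpath⟩ := exists_isInnerPath_of_linkConnected huv hg hc
  exact hinner ⟨j, ws, β, by omega, hpath⟩
end

section
/- Let m ∈ ℕ, let G be a coset (2m+1)-acyclic Cayley group with generator set E, let v, u ∈ G, let γ ⊆ gen(v,u), and set t = ρ(v,γ). Assume d_t(v,u) ≤ m and that there is a ∈ E with a ∉ short_t(v,u) such that d_t(v·a, u) ≤ m. Then a ∈ short_t(v·a, u). -/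
open scoped Pointwise

section CosetLemmas

theorem extLabel_of_mem {G : Type*} {ℓ i : ℕ} (α : ℕ → Set G) (h₁ : 1 ≤ i) (h₂ : i ≤ ℓ) :
    extLabel ℓ α i = α i :=
  if_pos ⟨h₁, h₂⟩

theorem inter_extLabel_succ {G : Type*} {ℓ i : ℕ} (α : ℕ → Set G) (h₁ : 1 ≤ i) (h₂ : i + 1 ≤ ℓ) :
    α i ∩ extLabel ℓ α (i + 1) = extLabel ℓ α i ∩ α (i + 1) := by
  rw [extLabel_of_mem α h₁ (by omega), extLabel_of_mem α (by omega) h₂]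

variable {G : Type*} [Group G]

theorem mem_coset_comm_s15 {v w : G} {α : Set G} : w ∈ coset v α ↔ v ∈ coset w α := by
  simp only [coset, Set.mem_ofPred_eq]
  rw [← inv_mem_iff]
  simp

theorem mem_coset_trans_s15 {v w x : G} {α : Set G} (h₁ : w ∈ coset v α) (h₂ : x ∈ coset w α) :
    x ∈ coset v α := by
  simp only [coset, Set.mem_ofPred_eq] at *
  simpa [mul_assoc] using mul_mem h₁ h₂

theorem coset_mono (v : G) {α β : Set G} (h : α ⊆ β) : coset v α ⊆ coset v β :=
  fun _ hx => Subgroup.closure_mono h hx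

theorem coset_empty (v : G) : coset v ∅ = {v} := by
  ext x
  simp [coset, inv_mul_eq_one, eq_comm]

theorem inter_coset_empty_eq_empty_iff {s : Set G} {v : G} : s ∩ coset v ∅ = ∅ ↔ v ∉ s := by
  rw [coset_empty, Set.inter_singleton_eq_empty]

/-- A cyclic sequence indexed by `0, …, n - 1` that satisfies the conditions of a coset cycle
cannot exist in a coset acyclic group. -/
theorem CosetAcyclic.false_of_cycle {E : Set G} {N : ℕ} (hE : CosetAcyclic E N) {n : ℕ}
    (h2 : 2 ≤ n) (hn : n ≤ N) (v : ℕ → G) (α : ℕ → Set G)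
    (hα : ∀ i < n, α i ⊆ E)
    (hstep : ∀ i, i + 1 < n → v (i + 1) ∈ coset (v i) (α i))
    (hclose : v 0 ∈ coset (v (n - 1)) (α (n - 1)))
    (hfirst : coset (v 0) (α (n - 1) ∩ α 0) ∩ coset (v 1) (α 0 ∩ α 1) = ∅)
    (hmid : ∀ i, i + 2 < n →
      coset (v (i + 1)) (α i ∩ α (i + 1)) ∩ coset (v (i + 2)) (α (i + 1) ∩ α (i + 2)) = ∅)
    (hlast : coset (v (n - 1)) (α (n - 2) ∩ α (n - 1)) ∩ coset (v 0) (α (n - 1) ∩ α 0) = ∅) :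
    False := by
  have : Fact (1 < n) := ⟨h2⟩
  have : NeZero n := ⟨by omega⟩
  have hsucc : ∀ i : ZMod n, i.val + 1 < n → (i + 1).val = i.val + 1 := fun i hi => by
    have := ZMod.val_add_of_lt (a := i) (b := 1) (by rwa [ZMod.val_one])
    rwa [ZMod.val_one] at this
  have hwrap : ∀ i : ZMod n, i.val + 1 = n → (i + 1).val = 0 := fun i hi => by
    rw [ZMod.val_add, ZMod.val_one, hi, Nat.mod_self]
  refine hE n (by omega) hn (fun i => v i.val) (fun i => α i.val)
    ⟨fun i => hα _ (ZMod.val_lt i), fun i => ?_, fun i => ?_⟩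
  · rcases (Nat.succ_le_of_lt (ZMod.val_lt i)).lt_or_eq with hi | hi
    · simp only [hsucc i hi]
      exact hstep _ hi
    · have hv : i.val = n - 1 := by omega
      simp only [hwrap i hi, hv]
      exact hclose
  · obtain ⟨j, rfl⟩ : ∃ j, i = j + 1 := ⟨i - 1, by ring⟩
    simp only [add_sub_cancel_right]
    rcases (Nat.succ_le_of_lt (ZMod.val_lt j)).lt_or_eq with hj | hj
    · have e1 := hsucc j hj
      rcases (Nat.succ_le_of_lt hj).lt_or_eq with hj' | hj'
      · have e2 := hsucc (j + 1) (by rw [e1]; exact hj')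
        simp only [e2, e1]
        exact hmid _ hj'
      · have e2 := hwrap (j + 1) (by rw [e1]; exact hj')
        have hv : j.val = n - 2 := by omega
        have hv' : n - 2 + 1 = n - 1 := by omega
        simp only [e2, e1, hv, hv']
        exact hlast
    · have e1 := hwrap j hj
      have e2 := hsucc (j + 1) (by rw [e1]; omega)
      have hv : j.val = n - 1 := by omega
      simp only [e2, e1, hv, zero_add]
      exact hfirst

/-- In a coset acyclic group, a coset path whose first vertex lies in its last link
is impossible, even if no disjointness is required of that last link. -/
theorem CosetAcyclic.false_of_closed_path {E : Set G} {N : ℕ} (hE : CosetAcyclic E N) {n : ℕ}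
    (h2 : 2 ≤ n) (hn : n ≤ N) (v : ℕ → G) (α : ℕ → Set G)
    (hα : ∀ i < n, α i ⊆ E)
    (hstep : ∀ i, i + 1 < n → v (i + 1) ∈ coset (v i) (α i))
    (hclose : v 0 ∈ coset (v (n - 1)) (α (n - 1)))
    (hfirst : v 0 ∉ coset (v 1) (α 0 ∩ α 1))
    (hmid : ∀ i, i + 2 < n →
      coset (v (i + 1)) (α i ∩ α (i + 1)) ∩ coset (v (i + 2)) (α (i + 1) ∩ α (i + 2)) = ∅) :
    False := by
  induction n, h2 using Nat.le_induction generalizing v α with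
  | base =>
    have key : coset (v 0) (α 1 ∩ α 0) ∩ coset (v 1) (α 0 ∩ α 1) = ∅ := by
      rw [Set.inter_comm (α 1)]
      by_contra hne
      obtain ⟨w, hw₀, hw₁⟩ := Set.nonempty_iff_ne_empty.2 hne
      exact hfirst (mem_coset_trans_s15 hw₁ (mem_coset_comm_s15.1 hw₀))
    exact hE.false_of_cycle le_rfl hn v α hα hstep hclose key hmid
      (by rw [Set.inter_comm]; exact key)
  | succ n h2 ih =>
    rw [Nat.add_sub_cancel] at hclose
    by_cases hf : coset (v 0) (α n ∩ α 0) ∩ coset (v 1) (α 0 ∩ α 1) = ∅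
    · by_cases hl : coset (v n) (α (n - 1) ∩ α n) ∩ coset (v 0) (α n ∩ α 0) = ∅
      · exact hE.false_of_cycle (by omega) hn v α hα hstep hclose hf hmid hl
      · obtain ⟨w, hwn, hw₀⟩ := Set.nonempty_iff_ne_empty.2 hl
        refine ih (by omega) (fun i => if i = 0 then w else v i) α
          (fun i hi => hα i (by omega)) (fun i hi => ?_) ?_ ?_ (fun i hi => ?_)
        · rcases i with _ | i
          · exact mem_coset_trans_s15
              (mem_coset_comm_s15.1 (coset_mono _ Set.inter_subset_right hw₀)) (hstep 0 (by omega))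
          · simpa using hstep (i + 1) (by omega)
        · have hs := hstep (n - 1) (by omega)
          rw [Nat.sub_add_cancel (by omega)] at hs
          simpa [show n - 1 ≠ 0 by omega] using
            mem_coset_trans_s15 hs (coset_mono _ Set.inter_subset_left hwn)
        · intro hw₁
          exact (hf.le ⟨hw₀, hw₁⟩ : w ∈ (∅ : Set G))
        · simpa using hmid i (by omega)
    · obtain ⟨w, hw₀, hw₁⟩ := Set.nonempty_iff_ne_empty.2 hf
      refine ih (by omega) (fun i => if i = 0 then w else v (i + 1)) (fun i => α (i + 1))
        (fun i hi => hα _ (by omega)) (fun i hi => ?_) ?_ ?_ (fun i hi => ?_)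
      · rcases i with _ | i
        · exact mem_coset_trans_s15
            (mem_coset_comm_s15.1 (coset_mono _ Set.inter_subset_right hw₁)) (hstep 1 (by omega))
        · simpa using hstep (i + 2) (by omega)
      · simpa [show n - 1 ≠ 0 by omega, show n - 1 + 1 = n by omega] using
          mem_coset_trans_s15 hclose (coset_mono _ Set.inter_subset_left hw₀)
      · intro hw₂
        rcases h2.lt_or_eq with h3 | rfl
        · exact (hmid 0 (by omega)).le ⟨hw₁, hw₂⟩
        · exact (hmid 0 (by omega)).le ⟨hw₁, hw₂⟩
      · simpa using hmid (i + 1) (by omega)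

/-- In a coset acyclic group, two coset paths issuing from the two ends of an `a`-edge and
ending in the same vertex cannot both avoid `a` in their first label. -/
theorem CosetAcyclic.mem_first_label {E : Set G} {N : ℕ} (hE : CosetAcyclic E N)
    {a : G} (ha : a ∈ E) (ha1 : a ≠ 1) {k ℓ : ℕ} (hN : ℓ + 1 + k ≤ N)
    {p q : ℕ → G} {α β : ℕ → Set G} (hp : IsCosetPath E ℓ p α) (hq : IsCosetPath E k q β)
    (hstart : q 1 = p 1 * a) (hend : p (ℓ + 1) = q (k + 1)) (haα : a ∉ α 1) : a ∈ β 1 := by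
  by_contra haβ
  obtain ⟨hℓ, hαE, -, hpstep, hplink⟩ := hp
  obtain ⟨hk, hβE, -, hqstep, hqlink⟩ := hq
  set x : ℕ → G := fun i => if i ≤ ℓ then p (ℓ + 1 - i) else q (i - ℓ) with hx
  set L : ℕ → Set G := fun i =>
    if i < ℓ then α (ℓ - i) else if i = ℓ then {a} else β (i - ℓ) with hL
  have hxp : ∀ j, 1 ≤ j → j ≤ ℓ + 1 → x (ℓ + 1 - j) = p j := fun j h1 h2 => by
    simp only [hx]
    rw [if_pos (by omega)]
    congr 1
    omega
  have hxq : ∀ j, 1 ≤ j → x (ℓ + j) = q j := fun j h1 => by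
    simp only [hx]
    rw [if_neg (by omega)]
    congr 1
    omega
  have hLp : ∀ j, 1 ≤ j → j ≤ ℓ → L (ℓ - j) = α j := fun j h1 h2 => by
    simp only [hL]
    rw [if_pos (by omega)]
    congr 1
    omega
  have hLa : L ℓ = {a} := by simp [hL]
  have hLq : ∀ j, 1 ≤ j → L (ℓ + j) = β j := fun j h1 => by
    simp only [hL]
    rw [if_neg (by omega), if_neg (by omega)]
    congr 1
    omega
  have hLLp : ∀ j, 1 ≤ j → j ≤ ℓ →
      L (ℓ - j) ∩ L (ℓ + 1 - j) = extLabel ℓ α (j - 1) ∩ α j := fun j h1 h2 => by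
    rw [hLp j h1 h2]
    rcases h1.eq_or_lt with rfl | h1
    · simp [extLabel, hLa, haα]
    · rw [show ℓ + 1 - j = ℓ - (j - 1) by omega, hLp _ (by omega) (by omega), Set.inter_comm,
        extLabel, if_pos (by omega)]
  have hLLq : ∀ j, 1 ≤ j → j ≤ k →
      L (ℓ + j - 1) ∩ L (ℓ + j) = extLabel k β (j - 1) ∩ β j := fun j h1 h2 => by
    rw [hLq j h1]
    rcases h1.eq_or_lt with rfl | h1
    · simp [extLabel, hLa, haβ]
    · rw [show ℓ + j - 1 = ℓ + (j - 1) by omega, hLq _ (by omega), extLabel, if_pos (by omega)]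
  refine hE.false_of_closed_path (n := ℓ + 1 + k) (by omega) hN x L (fun i hi => ?_)
    (fun i hi => ?_) ?_ ?_ (fun i hi => ?_)
  · rcases lt_trichotomy i ℓ with h | rfl | h
    · have := hLp (ℓ - i) (by omega) (by omega)
      rw [show ℓ - (ℓ - i) = i by omega] at this
      exact this ▸ hαE _ (by omega) (by omega)
    · simpa [hLa] using ha
    · obtain ⟨j, rfl⟩ := Nat.exists_eq_add_of_lt h
      rw [add_assoc, hLq _ (by omega)]
      exact hβE _ (by omega) (by omega)
  · rcases lt_trichotomy i ℓ with h | rfl | h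
    · obtain ⟨j, rfl⟩ := Nat.exists_eq_add_of_lt h
      have e1 := hxp (j + 1) (by omega) (by omega)
      have e2 := hxp (j + 2) (by omega) (by omega)
      have e3 := hLp (j + 1) (by omega) (by omega)
      rw [show i + j + 1 + 1 - (j + 1) = i + 1 by omega] at e1
      rw [show i + j + 1 + 1 - (j + 2) = i by omega] at e2
      rw [show i + j + 1 - (j + 1) = i by omega] at e3
      rw [e1, e2, e3]
      exact mem_coset_comm_s15.1 (hpstep (j + 1) (by omega) (by omega))
    · have e1 := hxp 1 le_rfl (by omega)
      rw [Nat.add_sub_cancel] at e1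
      rw [hxq 1 le_rfl, e1, hLa, hstart]
      simp [coset]
    · obtain ⟨j, rfl⟩ := Nat.exists_eq_add_of_lt h
      rw [show ℓ + j + 1 + 1 = ℓ + (j + 2) by omega, add_assoc, hxq _ (by omega),
        hxq _ (by omega), hLq _ (by omega)]
      exact hqstep (j + 1) (by omega) (by omega)
  · have e1 := hxp (ℓ + 1) (by omega) le_rfl
    rw [Nat.sub_self] at e1
    rw [show ℓ + 1 + k - 1 = ℓ + k by omega, e1, hxq k hk, hLq k hk, hend]
    exact hqstep k hk le_rfl
  · have e0 := hxp (ℓ + 1) (by omega) le_rfl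
    have e1 := hxp ℓ hℓ (by omega)
    have e2 := hLLp ℓ hℓ le_rfl
    rw [Nat.sub_self] at e0 e2
    rw [Nat.add_sub_cancel_left] at e1 e2
    rw [e0, e1, e2]
    have h := hplink ℓ hℓ le_rfl
    rwa [extLabel, extLabel, if_neg (by omega : ¬ (1 ≤ ℓ + 1 ∧ ℓ + 1 ≤ ℓ)), Set.inter_empty,
      inter_coset_empty_eq_empty_iff] at h
  · rcases lt_trichotomy (i + 1) ℓ with h | h | h
    · obtain ⟨j, rfl⟩ := Nat.exists_eq_add_of_lt h
      have e1 := hxp (j + 1) (by omega) (by omega)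
      have e2 := hxp (j + 2) (by omega) (by omega)
      have e3 := hLLp (j + 1) (by omega) (by omega)
      have e4 := hLLp (j + 2) (by omega) (by omega)
      rw [show i + 1 + j + 1 + 1 - (j + 1) = i + 2 by omega] at e1 e3
      rw [show i + 1 + j + 1 + 1 - (j + 2) = i + 1 by omega] at e2 e4
      rw [show i + 1 + j + 1 - (j + 1) = i + 1 by omega] at e3
      rw [show i + 1 + j + 1 - (j + 2) = i by omega] at e4
      rw [e1, e2, e3, e4, Set.inter_comm]
      have hl := hplink (j + 1) (by omega) (by omega)
      rwa [inter_extLabel_succ _ (by omega) (by omega)] at hl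
    · subst h
      have e1 := hxp 1 le_rfl (by omega)
      have e3 := hLLp 1 le_rfl (by omega)
      rw [Nat.add_sub_cancel] at e1 e3
      rw [Nat.add_sub_cancel] at e3
      have e4 := hLLq 1 le_rfl hk
      rw [Nat.add_sub_cancel] at e4
      rw [e1, e3, show i + 2 = i + 1 + 1 from rfl, e4, hxq 1 le_rfl, hstart]
      simpa [extLabel, coset_empty] using ha1
    · obtain ⟨j, hj⟩ : ∃ j, i + 1 = ℓ + (j + 1) := ⟨i - ℓ, by omega⟩
      rw [show i = ℓ + (j + 1) - 1 by omega, show ℓ + (j + 1) - 1 + 1 = ℓ + (j + 1) by omega,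
        hLLq _ (by omega) (by omega), hxq _ (by omega),
        show ℓ + (j + 1) - 1 + 2 = ℓ + (j + 2) by omega, hxq _ (by omega)]
      rw [hLq _ (by omega), hLq _ (by omega)]
      have hl := hqlink (j + 1) (by omega) (by omega)
      rwa [extLabel_of_mem _ (by omega : 1 ≤ j + 1 + 1) (by omega)] at hl

end CosetLemmas

/-- in a coset `(2m+1)`-acyclic Cayley group, with `γ ⊆ gen(v,u)` and
`t = ρ(v,γ)`: if `d_t(v,u) ≤ m`, `a ∈ E` with `a ∉ short_t(v,u)` and `d_t(v·a,u) ≤ m`,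
then `a ∈ short_t(v·a,u)` (i.e. `a` belongs to the first label of every non-`t` coset
path of length `≤ m` from `v·a` to `u`). -/
theorem step_away_t {G : Type*} [Group G] (m : ℕ) (E : Set G) (hC : IsCayley E)
    (hacyc : CosetAcyclic E (2 * m + 1)) (v u : G)
    (g : Set G) (hg : IsGen E v u g) (γ : Set G) (hγ : γ ⊆ g)
    (hd1 : ∃ (ℓ : ℕ) (vs : ℕ → G) (α : ℕ → Set G),
        ℓ ≤ m ∧ IsNonTPath E v γ ℓ vs α ∧ vs 1 = v ∧ vs (ℓ + 1) = u)
    (a : G) (ha : a ∈ E)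
    (hshort : ∃ (ℓ : ℕ) (vs : ℕ → G) (α : ℕ → Set G),
        ℓ ≤ m ∧ IsNonTPath E v γ ℓ vs α ∧ vs 1 = v ∧ vs (ℓ + 1) = u ∧ a ∉ α 1)
    (hd2 : ∃ (ℓ : ℕ) (vs : ℕ → G) (α : ℕ → Set G),
        ℓ ≤ m ∧ IsNonTPath E v γ ℓ vs α ∧ vs 1 = v * a ∧ vs (ℓ + 1) = u) :
    ∀ (ℓ : ℕ) (vs : ℕ → G) (α : ℕ → Set G),
      ℓ ≤ m → IsNonTPath E v γ ℓ vs α → vs 1 = v * a → vs (ℓ + 1) = u → a ∈ α 1 := by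
  intro ℓ vs α hℓ hpath hstart hend
  obtain ⟨k, p, β, hk, hp, hp1, hpe, haβ⟩ := hshort
  exact hacyc.mem_first_label ha (hC.1 a ha).1 (by omega) hp.1 hpath.1
    (by rw [hstart, hp1]) (hpe.trans hend.symm) haβ
end
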